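/- Let Π be the class of quadratic functions π(x) = xᵀWx + vᵀx on ℝ^d (W ∈ ℝ^{d×d}, v ∈ ℝ^d), let δ ∈ (0,1], α ∈ (0,1), and let C be a fixed measurable set-valued predictor. Suppose C provides exact conditional coverage at level 1 − α over all quadratic slabs, i.e., P(Y ∈ C(X) | a ≤ π(X) ≤ b) ≥ 1 − α for every π ∈ Π and every a < b. Then there is a universal constant K > 0 such that for an i.i.d. sample of size N and every τ > 0, with probability at least 1 − e^{−τ}, the empirical worst-slab coverage satisfies WSC⁺_n = inf_{π ∈ Π} WSC⁺_n(C, π) ≥ 1 − α − K·√((d²·log N + τ)/(δ·N)). -/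

import Mathlib

open MeasureTheory

/-- The quadratic function `π(x) = xᵀWx + vᵀx` on `ℝ^d`. -/
noncomputable def quadFn {d : ℕ} (W : Matrix (Fin d) (Fin d) ℝ) (v : Fin d → ℝ)
    (x : Fin d → ℝ) : ℝ :=
  (∑ i, ∑ j, W i j * x i * x j) + ∑ i, v i * x i

/-- The empirical worst-slab coverage `WSC⁺_n(C, π)` of the set-valued predictor `C` on
the sample `ω` along the feature map `π` at mass level `δ`: the infimum, over slabs
`a < b` with empirical mass at least `δ`, of the empirical conditional coverage. -/
noncomputable def WSCplus {d N : ℕ} {𝒴 : Type*} (ω : Fin N → (Fin d → ℝ) × 𝒴)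
    (C : (Fin d → ℝ) → Set 𝒴) (δ : ℝ) (π : (Fin d → ℝ) → ℝ) : ℝ :=
  sInf {r : ℝ | ∃ a b : ℝ, a < b ∧
    δ ≤ (Nat.card {i : Fin N // a ≤ π (ω i).1 ∧ π (ω i).1 ≤ b} : ℝ) / N ∧
    r = (Nat.card {i : Fin N // (a ≤ π (ω i).1 ∧ π (ω i).1 ≤ b) ∧ (ω i).2 ∈ C (ω i).1} : ℝ) /
        (Nat.card {i : Fin N // a ≤ π (ω i).1 ∧ π (ω i).1 ≤ b} : ℝ)}

theorem Finset.vcDim_le_finrank_of_nonneg {J E : Type*} [DecidableEq J]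
    [AddCommGroup E] [Module ℝ E] [FiniteDimensional ℝ E] (L : E →ₗ[ℝ] (J → ℝ))
    (𝒜 : Finset (Finset J)) (h : ∀ A ∈ 𝒜, ∃ e, ∀ j, j ∈ A ↔ 0 ≤ L e j) :
    𝒜.vcDim ≤ Module.finrank ℝ E := by
  refine Finset.sup_le fun s hs => ?_
  rw [Finset.mem_shatterer] at hs
  by_contra! hcard
  let R : E →ₗ[ℝ] (s → ℝ) := (LinearMap.funLeft ℝ ℝ (Subtype.val : s → J)) ∘ₗ L
  have hlt : LinearMap.range R < ⊤ := by
    rw [lt_top_iff_ne_top]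
    intro htop
    have h1 := LinearMap.finrank_range_le R
    rw [htop, finrank_top, Module.finrank_fintype_fun_eq_card, Fintype.card_coe] at h1
    omega
  obtain ⟨f, hf0, hf⟩ := Submodule.exists_le_ker_of_lt_top _ hlt
  have key : ∀ g : (s → ℝ) →ₗ[ℝ] ℝ, (∀ e, g (R e) = 0) →
      ∀ i, 0 ≤ g (Pi.single i 1) := by
    intro g hg
    by_contra! hneg
    obtain ⟨i₀, hi₀⟩ := hneg
    let t : Finset J := (Finset.univ.filter fun i : s => 0 ≤ g (Pi.single i 1)).map
      (Function.Embedding.subtype _)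
    have ht : t ⊆ s := by
      intro j hj
      simp only [t, Finset.mem_map] at hj
      obtain ⟨i, -, rfl⟩ := hj
      exact i.2
    obtain ⟨u, hu, hsu⟩ := hs ht
    obtain ⟨e, he⟩ := h u hu
    have hmem : ∀ i : s, 0 ≤ R e i ↔ 0 ≤ g (Pi.single i 1) := by
      intro i
      have h1 : (i : J) ∈ u ↔ (i : J) ∈ t := by
        rw [← hsu, Finset.mem_inter]
        exact ⟨fun h => ⟨i.2, h⟩, fun h => h.2⟩
      have h2 : (i : J) ∈ t ↔ 0 ≤ g (Pi.single i 1) := by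
        simp [t]
      rw [← h2, ← h1, he]
      rfl
    have hsum := LinearMap.pi_apply_eq_sum_univ g (R e)
    rw [hg e] at hsum
    have hpos : 0 < ∑ i, R e i • g (Pi.single i 1) := by
      refine Finset.sum_pos' (fun i _ => ?_) ⟨i₀, Finset.mem_univ _, ?_⟩
      · by_cases hi : 0 ≤ g (Pi.single i 1)
        · exact mul_nonneg ((hmem i).2 hi) hi
        · exact mul_nonneg_of_nonpos_of_nonpos (not_le.1 (mt (hmem i).1 hi)).le (not_le.1 hi).le
      · exact mul_pos_of_neg_of_neg (not_le.1 (mt (hmem i₀).1 (not_le.2 hi₀))) hi₀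
    have : ∑ i, R e i • g (Pi.single i 1) = ∑ i, R e i • g fun j ↦ if i = j then 1 else 0 := by
      refine Finset.sum_congr rfl fun i _ => ?_
      congr 2
      ext j
      simp [Pi.single_apply, eq_comm]
    linarith
  have hfR : ∀ e, f (R e) = 0 := fun e => hf ⟨e, rfl⟩
  refine hf0 (LinearMap.pi_ext' fun i => LinearMap.ext_ring ?_)
  have h1 := key f hfR i
  have h2 := key (-f) (fun e => by simp [hfR]) i
  simp only [LinearMap.neg_apply] at h2
  simp only [LinearMap.comp_apply, LinearMap.single_apply, LinearMap.zero_apply]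
  linarith

theorem Nat.sum_choose_Iic_le_pow (m D : ℕ) :
    ∑ k ∈ Finset.Iic D, m.choose k ≤ (m + 1) ^ D := by
  induction D with
  | zero => rw [show Finset.Iic 0 = {0} from rfl]; simp
  | succ D ih =>
    have : Finset.Iic (D + 1) = insert (D + 1) (Finset.Iic D) := by
      ext; simp; omega
    rw [this, Finset.sum_insert (by simp), pow_succ]
    have h1 := Nat.choose_le_pow m (D + 1)
    have h2 : m ^ (D + 1) ≤ (m + 1) ^ D * m := by
      rw [pow_succ]; gcongr; omega
    linarith

theorem sum_exp_signs_le {N : ℕ} (x y : Fin N → ℝ) (h : ∀ i, x i ^ 2 / 2 ≤ y i) :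
    ∑ σ : Fin N → Bool, Real.exp (∑ i, ((if σ i then -x i else x i) - y i)) ≤ 2 ^ N := by
  simp_rw [Real.exp_sum]
  rw [← Fintype.prod_sum (fun i (b : Bool) => Real.exp ((if b then -x i else x i) - y i))]
  refine (Finset.prod_le_prod (g := fun _ => (2 : ℝ)) (fun i _ => by positivity)
    fun i _ => ?_).trans (by simp)
  simp only [Fintype.sum_bool, if_true, Bool.false_eq_true, if_false, Real.exp_sub]
  rw [← add_div, div_le_iff₀ (Real.exp_pos _)]
  have h1 := Real.cosh_le_exp_half_sq (x i)
  rw [Real.cosh_eq] at h1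
  have h2 := Real.exp_le_exp.2 (h i)
  linarith

theorem lintegral_iSup_exp_symmetrized_le {E ι : Type*} [MeasurableSpace E] (P : Measure E)
    [IsProbabilityMeasure P] [Countable ι] {N : ℕ} (φ w : ι → E → ℝ)
    (hφ : ∀ k, Measurable (φ k)) (hw : ∀ k, Measurable (w k))
    (hφw : ∀ k a b, (φ k a - φ k b) ^ 2 / 2 ≤ w k a + w k b) (G : ℕ)
    (hG : ∀ z : Fin N × Bool → E, ∃ Q : Finset ι, Q.card ≤ G ∧
      ∀ k, ∃ k' ∈ Q, ∀ j, φ k (z j) = φ k' (z j) ∧ w k (z j) = w k' (z j)) :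
    ∫⁻ ζ, ⨆ k, ENNReal.ofReal (Real.exp (∑ i, (φ k (ζ i).1 - φ k (ζ i).2 -
      (w k (ζ i).1 + w k (ζ i).2)))) ∂(Measure.pi fun _ : Fin N => P.prod P) ≤ G := by
  set F : (Fin N → E × E) → ENNReal := fun ζ => ⨆ k, ENNReal.ofReal (Real.exp
    (∑ i, (φ k (ζ i).1 - φ k (ζ i).2 - (w k (ζ i).1 + w k (ζ i).2)))) with hF
  have hFm : Measurable F := by
    refine Measurable.iSup fun k => ?_
    have := hφ k
    have := hw k
    fun_prop
  let T : (Fin N → Bool) → (Fin N → E × E) → (Fin N → E × E) := fun σ ζ i =>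
    (if σ i then Prod.swap else id) (ζ i)
  have hT : ∀ σ, MeasurePreserving (T σ) (Measure.pi fun _ : Fin N => P.prod P)
      (Measure.pi fun _ : Fin N => P.prod P) := by
    intro σ
    refine measurePreserving_pi _ _ (f := fun i => if σ i then Prod.swap else id) fun i => ?_
    split_ifs
    · exact Measure.measurePreserving_swap
    · exact MeasurePreserving.id _
  have hpt : ∀ ζ, ∑ σ, F (T σ ζ) ≤ (2 ^ N : ENNReal) * G := by
    intro ζ
    obtain ⟨Q, hQ, hQk⟩ := hG fun j => if j.2 then (ζ j.1).2 else (ζ j.1).1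
    let f : ι → (Fin N → Bool) → ℝ := fun k σ => Real.exp (∑ i,
      ((if σ i then -(φ k (ζ i).1 - φ k (ζ i).2) else φ k (ζ i).1 - φ k (ζ i).2) -
        (w k (ζ i).1 + w k (ζ i).2)))
    have hFf : ∀ σ, F (T σ ζ) = ⨆ k, ENNReal.ofReal (f k σ) := by
      intro σ
      simp only [hF, f]
      congr! 5 with k i
      simp only [T]
      split_ifs
      · simp; ring
      · simp
    have hle : ∀ σ, F (T σ ζ) ≤ ∑ k ∈ Q, ENNReal.ofReal (f k σ) := by
      intro σ
      rw [hFf]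
      refine iSup_le fun k => ?_
      obtain ⟨k', hk', hkk⟩ := hQk k
      have h1 : ∀ i, φ k (ζ i).1 = φ k' (ζ i).1 ∧ w k (ζ i).1 = w k' (ζ i).1 :=
        fun i => by simpa using hkk (i, false)
      have h2 : ∀ i, φ k (ζ i).2 = φ k' (ζ i).2 ∧ w k (ζ i).2 = w k' (ζ i).2 :=
        fun i => by simpa using hkk (i, true)
      have : f k σ = f k' σ := by
        simp only [f, (h1 _).1, (h1 _).2, (h2 _).1, (h2 _).2]
      rw [this]
      exact Finset.single_le_sum (f := fun k => ENNReal.ofReal (f k σ))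
        (fun _ _ => zero_le) hk'
    calc ∑ σ, F (T σ ζ) ≤ ∑ σ, ∑ k ∈ Q, ENNReal.ofReal (f k σ) :=
          Finset.sum_le_sum fun σ _ => hle σ
      _ = ∑ k ∈ Q, ENNReal.ofReal (∑ σ, f k σ) := by
          rw [Finset.sum_comm]
          refine Finset.sum_congr rfl fun k _ => ?_
          rw [ENNReal.ofReal_sum_of_nonneg fun _ _ => (Real.exp_pos _).le]
      _ ≤ ∑ k ∈ Q, (2 ^ N : ENNReal) := by
          refine Finset.sum_le_sum fun k _ => ?_
          refine (ENNReal.ofReal_le_ofReal (sum_exp_signs_le _ _ fun i => hφw k _ _)).trans_eq ?_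
          rw [ENNReal.ofReal_pow (by norm_num)]
          simp
      _ ≤ (2 ^ N : ENNReal) * G := by
          rw [Finset.sum_const, nsmul_eq_mul, mul_comm]
          gcongr
  have havg : (2 ^ N : ENNReal) * ∫⁻ ζ, F ζ ∂(Measure.pi fun _ : Fin N => P.prod P) ≤
      (2 ^ N : ENNReal) * G := by
    calc (2 ^ N : ENNReal) * ∫⁻ ζ, F ζ ∂(Measure.pi fun _ : Fin N => P.prod P)
        = ∑ σ : Fin N → Bool, ∫⁻ ζ, F (T σ ζ) ∂(Measure.pi fun _ : Fin N => P.prod P) := by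
          simp_rw [(hT _).lintegral_comp hFm]
          simp
      _ = ∫⁻ ζ, ∑ σ : Fin N → Bool, F (T σ ζ) ∂(Measure.pi fun _ : Fin N => P.prod P) :=
          (lintegral_finsetSum _ fun σ _ => hFm.comp (hT σ).measurable).symm
      _ ≤ ∫⁻ ζ, (2 ^ N : ENNReal) * G ∂(Measure.pi fun _ : Fin N => P.prod P) :=
          lintegral_mono hpt
      _ = _ := by simp
  exact (ENNReal.mul_le_mul_iff_right (by simp) (by simp)).1 havg

theorem measure_pi_exists_le_sum_le {E ι : Type*} [MeasurableSpace E] (P : Measure E)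
    [IsProbabilityMeasure P] [Countable ι] {N : ℕ} (φ w : ι → E → ℝ)
    (hφ : ∀ k, Measurable (φ k)) (hw : ∀ k, Measurable (w k))
    (hφw : ∀ k a b, (φ k a - φ k b) ^ 2 / 2 ≤ w k a + w k b)
    (h_integrable : ∀ k, Integrable (fun e => φ k e + w k e) P)
    (hmean : ∀ k, ∫ e, (φ k e + w k e) ∂P ≤ 0) (G : ℕ)
    (hG : ∀ z : Fin N × Bool → E, ∃ Q : Finset ι, Q.card ≤ G ∧
      ∀ k, ∃ k' ∈ Q, ∀ j, φ k (z j) = φ k' (z j) ∧ w k (z j) = w k' (z j)) (m : ℝ) :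
    (Measure.pi fun _ : Fin N => P) {ω | ∃ k, m ≤ ∑ i, (φ k (ω i) - w k (ω i))} ≤
      ENNReal.ofReal (G * Real.exp (-m)) := by
  set μ := Measure.pi fun _ : Fin N => P
  set F : (Fin N → E × E) → ENNReal := fun ζ => ⨆ k, ENNReal.ofReal (Real.exp
    (∑ i, (φ k (ζ i).1 - φ k (ζ i).2 - (w k (ζ i).1 + w k (ζ i).2)))) with hF
  have hFm : Measurable F := by
    refine Measurable.iSup fun k => ?_
    have := hφ k
    have := hw k
    fun_prop
  let e := MeasurableEquiv.arrowProdEquivProdArrow E E (Fin N)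
  have hFe : Measurable fun p => F (e.symm p) := hFm.comp e.symm.measurable
  have hFint : ∫⁻ ω, ∫⁻ ω', F (e.symm (ω, ω')) ∂μ ∂μ ≤ G := by
    refine le_trans (le_of_eq ?_) (lintegral_iSup_exp_symmetrized_le P φ w hφ hw hφw G hG)
    rw [← lintegral_prod _ hFe.aemeasurable,
      ← (measurePreserving_arrowProdEquivProdArrow E E (Fin N) (fun _ => P)
        (fun _ => P)).lintegral_comp hFe]
    simp only [e, MeasurableEquiv.symm_apply_apply, hF]
  have hghost : ∀ k, 1 ≤ ∫⁻ ω' : Fin N → E,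
      ENNReal.ofReal (Real.exp (-∑ i, (φ k (ω' i) + w k (ω' i)))) ∂μ := by
    intro k
    have hi : ∀ i, Integrable (fun ω' : Fin N → E => φ k (ω' i) + w k (ω' i)) μ := fun i =>
      integrable_comp_eval (μ := fun _ : Fin N => P) (i := i) (h_integrable k)
    have h1 : 1 ≤ ∫ ω', (1 - ∑ i, (φ k (ω' i) + w k (ω' i))) ∂μ := by
      rw [integral_sub (integrable_const _) (integrable_finsetSum _ fun i _ => hi i),
        integral_finsetSum _ fun i _ => hi i]
      have : ∑ i, ∫ ω' : Fin N → E, (φ k (ω' i) + w k (ω' i)) ∂μ ≤ 0 := by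
        refine Finset.sum_nonpos fun i _ => ?_
        rw [integral_comp_eval (μ := fun _ : Fin N => P) (i := i) (h_integrable k).aestronglyMeasurable]
        exact hmean k
      simp only [integral_const, probReal_univ, smul_eq_mul, one_mul]
      linarith
    calc (1 : ENNReal) = ENNReal.ofReal 1 := by simp
      _ ≤ ENNReal.ofReal (∫ ω', (1 - ∑ i, (φ k (ω' i) + w k (ω' i))) ∂μ) :=
        ENNReal.ofReal_le_ofReal h1
      _ ≤ ∫⁻ ω', ENNReal.ofReal (1 - ∑ i, (φ k (ω' i) + w k (ω' i))) ∂μ := by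
        rw [integral_eq_lintegral_pos_part_sub_lintegral_neg_part
          (Integrable.sub' (integrable_const _) (integrable_finsetSum _ fun i _ => hi i))]
        exact (ENNReal.ofReal_le_ofReal (sub_le_self _ ENNReal.toReal_nonneg)).trans
          ENNReal.ofReal_toReal_le
      _ ≤ _ := by
        refine lintegral_mono fun ω' => ENNReal.ofReal_le_ofReal ?_
        have := Real.add_one_le_exp (-∑ i, (φ k (ω' i) + w k (ω' i)))
        linarith
  have hsub : {ω | ∃ k, m ≤ ∑ i, (φ k (ω i) - w k (ω i))} ⊆
      {ω | ENNReal.ofReal (Real.exp m) ≤ ∫⁻ ω', F (e.symm (ω, ω')) ∂μ} := by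
    rintro ω ⟨k, hk⟩
    calc ENNReal.ofReal (Real.exp m)
        ≤ ENNReal.ofReal (Real.exp (∑ i, (φ k (ω i) - w k (ω i)))) * 1 := by
          rw [mul_one]
          exact ENNReal.ofReal_le_ofReal (Real.exp_le_exp.2 hk)
      _ ≤ ENNReal.ofReal (Real.exp (∑ i, (φ k (ω i) - w k (ω i)))) * ∫⁻ ω' : Fin N → E,
          ENNReal.ofReal (Real.exp (-∑ i, (φ k (ω' i) + w k (ω' i)))) ∂μ := by
          gcongr
          exact hghost k
      _ = ∫⁻ ω' : Fin N → E, ENNReal.ofReal (Real.exp (∑ i, (φ k (ω i) - w k (ω i)))) *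
          ENNReal.ofReal (Real.exp (-∑ i, (φ k (ω' i) + w k (ω' i)))) ∂μ :=
          (lintegral_const_mul' _ _ ENNReal.ofReal_ne_top).symm
      _ ≤ _ := by
          refine lintegral_mono fun ω' => ?_
          rw [← ENNReal.ofReal_mul (Real.exp_pos _).le, ← Real.exp_add,
            ← Finset.sum_neg_distrib, ← Finset.sum_add_distrib]
          refine le_trans (le_of_eq ?_) (le_iSup _ k)
          congr! 3 with i
          simp only [e, MeasurableEquiv.arrowProdEquivProdArrow, Equiv.arrowProdEquivProdArrow]
          simp
          ring
  refine (measure_mono hsub).trans ?_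
  refine (meas_ge_le_lintegral_div hFe.lintegral_prod_right'.aemeasurable ?_ ?_).trans ?_
  · simp [Real.exp_pos]
  · exact ENNReal.ofReal_ne_top
  · rw [ENNReal.ofReal_mul (by positivity), Real.exp_neg, ENNReal.ofReal_inv_of_pos
      (Real.exp_pos _), ENNReal.ofReal_natCast, ENNReal.div_eq_inv_mul, mul_comm]
    gcongr

theorem measure_pi_exists_coverage_le {E ι : Type*} [MeasurableSpace E] (P : Measure E)
    [IsProbabilityMeasure P] [Countable ι] {N : ℕ} (s : ι → Set E) (K : Set E)
    (hs : ∀ k, MeasurableSet (s k)) (hK : MeasurableSet K) {c ε : ℝ} (hc0 : 0 ≤ c) (hc1 : c ≤ 1)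
    (hε0 : 0 < ε) (hε1 : ε ≤ 1) (hcov : ∀ k, c * P.real (s k) ≤ P.real (s k ∩ K)) (G : ℕ)
    (hG : ∀ z : Fin N × Bool → E, ∃ 𝒜 : Finset (Finset (Fin N × Bool)), 𝒜.card ≤ G ∧
      ∀ k, ∃ A ∈ 𝒜, ∀ j, j ∈ A ↔ z j ∈ s k) (m : ℝ) :
    (Measure.pi fun _ : Fin N => P)
        {ω | ∃ k, m ≤ (Nat.card {i // ω i ∈ s k} : ℝ) ∧
          (Nat.card {i // ω i ∈ s k ∩ K} : ℝ) ≤ (c - ε) * Nat.card {i // ω i ∈ s k}} ≤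
      ENNReal.ofReal (G * Real.exp (-(ε ^ 2 * m / 36))) := by
  classical
  let φ : ι → E → ℝ := fun k =>
    (s k).indicator (fun e => ε / 9 * (c - ε / 2 - K.indicator (fun _ => 1) e))
  let w : ι → E → ℝ := fun k => (s k).indicator (fun _ => ε ^ 2 / 36)
  have hφ : ∀ k, Measurable (φ k) := fun k =>
    (((measurable_const.indicator hK).const_sub _).const_mul _).indicator (hs k)
  have hw : ∀ k, Measurable (w k) := fun k => measurable_const.indicator (hs k)
  have hsum : ∀ k, (fun e => φ k e + w k e) = fun e =>
      (s k).indicator (fun _ => ε / 9 * (c - ε / 4)) e - (s k ∩ K).indicator (fun _ => ε / 9) e := by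
    intro k
    ext e
    by_cases h1 : e ∈ s k <;> by_cases h2 : e ∈ K <;> simp [φ, w, h1, h2] <;> ring
  have hi1 : ∀ k, Integrable ((s k).indicator fun _ => ε / 9 * (c - ε / 4)) P := fun k =>
    (integrable_const _).indicator (hs k)
  have hi2 : ∀ k, Integrable ((s k ∩ K).indicator fun _ => ε / 9) P := fun k =>
    (integrable_const _).indicator ((hs k).inter hK)
  refine le_trans (measure_mono ?_) (measure_pi_exists_le_sum_le P φ w hφ hw ?_ ?_ ?_ G ?_ _)
  · rintro ω ⟨k, hm, hk⟩
    refine ⟨k, ?_⟩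
    have hcard : ∀ S : Set E, (Nat.card {i // ω i ∈ S} : ℝ) =
        ∑ i, S.indicator (fun _ => (1 : ℝ)) (ω i) := by
      intro S
      rw [Nat.card_eq_fintype_card, Fintype.card_subtype]
      simp [Set.indicator_apply]
    have : ∑ i, (φ k (ω i) - w k (ω i)) = ε / 9 * ((c - 3 * ε / 4) *
        (Nat.card {i // ω i ∈ s k} : ℝ) - Nat.card {i // ω i ∈ s k ∩ K}) := by
      rw [hcard, hcard, Finset.mul_sum, ← Finset.sum_sub_distrib, Finset.mul_sum]
      refine Finset.sum_congr rfl fun i _ => ?_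
      by_cases h1 : ω i ∈ s k <;> by_cases h2 : ω i ∈ K <;> simp [φ, w, h1, h2] <;> ring
    rw [this]
    calc ε ^ 2 * m / 36 = ε / 9 * (ε / 4 * m) := by ring
      _ ≤ ε / 9 * (ε / 4 * Nat.card {i // ω i ∈ s k}) := by gcongr
      _ ≤ _ := by gcongr; linarith
  · have hsq : ∀ k a, φ k a ^ 2 ≤ w k a := by
      intro k a
      by_cases h1 : a ∈ s k
      · have h2 : 0 ≤ K.indicator (fun _ => (1 : ℝ)) a :=
          Set.indicator_nonneg (fun _ _ => zero_le_one) a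
        have h3 : K.indicator (fun _ => (1 : ℝ)) a ≤ 1 := Set.indicator_le_self' (by simp) a
        simp only [φ, w, h1, Set.indicator_of_mem]
        have h4 : (c - ε / 2 - K.indicator (fun _ => (1 : ℝ)) a) ^ 2 ≤ (3 / 2) ^ 2 :=
          sq_le_sq' (by linarith) (by linarith)
        rw [mul_pow]
        calc _ ≤ (ε / 9) ^ 2 * (3 / 2) ^ 2 := by gcongr
          _ = ε ^ 2 / 36 := by ring
      · simp [φ, w, h1]
    intro k a b
    nlinarith [hsq k a, hsq k b, sq_nonneg (φ k a + φ k b)]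
  · intro k
    rw [hsum]
    exact (hi1 k).sub (hi2 k)
  · intro k
    rw [hsum, integral_sub (hi1 k) (hi2 k), integral_indicator_const _ (hs k),
      integral_indicator_const _ ((hs k).inter hK)]
    simp only [smul_eq_mul]
    have h1 : 0 ≤ ε ^ 2 / 36 * P.real (s k) := by positivity
    have h2 := mul_le_mul_of_nonneg_left (hcov k) (show 0 ≤ ε / 9 by positivity)
    linarith
  · intro z
    obtain ⟨𝒜, hcard, h𝒜⟩ := hG z
    rcases isEmpty_or_nonempty ι with hι | ⟨⟨k₀⟩⟩
    · exact ⟨∅, by simp, fun k => hι.elim k⟩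
    let rep : Finset (Fin N × Bool) → ι := fun A =>
      if h : ∃ k, ∀ j, j ∈ A ↔ z j ∈ s k then h.choose else k₀
    refine ⟨𝒜.image rep, Finset.card_image_le.trans hcard, fun k => ?_⟩
    obtain ⟨A, hA, hAk⟩ := h𝒜 k
    refine ⟨rep A, Finset.mem_image_of_mem _ hA, fun j => ?_⟩
    have h : ∃ k, ∀ j, j ∈ A ↔ z j ∈ s k := ⟨k, hAk⟩
    have hrep : z j ∈ s k ↔ z j ∈ s (rep A) := by
      rw [← hAk j, h.choose_spec j]
      simp only [rep, dif_pos h]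
    simp only [φ, w, Set.indicator_apply, hrep, and_self]

theorem exists_finset_slab_patterns {d : ℕ} {J : Type*} [Fintype J] [DecidableEq J]
    (x : J → Fin d → ℝ) :
    ∃ 𝒜 : Finset (Finset J), 𝒜.card ≤ (Fintype.card J + 1) ^ (2 * (d * d + d + 1)) ∧
      ∀ (W : Matrix (Fin d) (Fin d) ℝ) (v : Fin d → ℝ) (a b : ℝ), ∃ A ∈ 𝒜,
        ∀ j, j ∈ A ↔ a ≤ quadFn W v (x j) ∧ quadFn W v (x j) ≤ b := by
  classical
  let L : (Matrix (Fin d) (Fin d) ℝ × (Fin d → ℝ) × ℝ) →ₗ[ℝ] (J → ℝ) :=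
    { toFun := fun θ j => quadFn θ.1 θ.2.1 (x j) + θ.2.2
      map_add' := fun θ θ' => by
        ext j
        simp only [quadFn, Prod.fst_add, Prod.snd_add, Matrix.add_apply, Pi.add_apply, add_mul,
          Finset.sum_add_distrib]
        ring
      map_smul' := fun r θ => by
        ext j
        simp only [quadFn, Prod.smul_fst, Prod.smul_snd, Matrix.smul_apply, Pi.smul_apply,
          smul_eq_mul, mul_assoc, ← Finset.mul_sum, RingHom.id_apply]
        ring }
  let ℋ : Finset (Finset J) := Finset.univ.filter fun A => ∃ θ, ∀ j, j ∈ A ↔ 0 ≤ L θ j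
  have hrank : Module.finrank ℝ (Matrix (Fin d) (Fin d) ℝ × (Fin d → ℝ) × ℝ) = d * d + d + 1 := by
    simp [Module.finrank_prod, Module.finrank_matrix, add_assoc]
  have hdim : ℋ.vcDim ≤ d * d + d + 1 :=
    hrank ▸ Finset.vcDim_le_finrank_of_nonneg L ℋ fun A hA => (Finset.mem_filter.1 hA).2
  have hℋ : ℋ.card ≤ (Fintype.card J + 1) ^ (d * d + d + 1) :=
    calc ℋ.card ≤ ℋ.shatterer.card := ℋ.card_le_card_shatterer
      _ ≤ ∑ k ∈ Finset.Iic ℋ.vcDim, (Fintype.card J).choose k :=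
          Finset.card_shatterer_le_sum_vcDim
      _ ≤ (Fintype.card J + 1) ^ ℋ.vcDim := Nat.sum_choose_Iic_le_pow _ _
      _ ≤ _ := Nat.pow_le_pow_right (Nat.succ_pos _) hdim
  have hmem : ∀ θ, (Finset.univ.filter fun j => 0 ≤ L θ j) ∈ ℋ := fun θ => by
    simp only [ℋ, Finset.mem_filter, Finset.mem_univ, true_and]
    exact ⟨θ, fun _ => Iff.rfl⟩
  refine ⟨Finset.image₂ (· ∩ ·) ℋ ℋ, ?_, fun W v a b => ⟨_, Finset.mem_image₂_of_mem
    (hmem (W, v, -a)) (hmem (-W, -v, b)), fun j => ?_⟩⟩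
  · rw [two_mul, pow_add]
    exact (Finset.card_image₂_le _ _ _).trans (Nat.mul_le_mul hℋ hℋ)
  · have hneg : quadFn (-W) (-v) (x j) = -quadFn W v (x j) := by
      simp [quadFn, Finset.sum_neg_distrib]
      ring
    simp only [Finset.mem_inter, Finset.mem_filter, Finset.mem_univ, true_and, L,
      LinearMap.coe_mk, AddHom.coe_mk, hneg]
    constructor <;> rintro ⟨h1, h2⟩ <;> constructor <;> linarith

/-- A slab of a quadratic with real coefficients meets a finite set of points like some slab
whose parameters lie in a given dense set. -/
theorem exists_mem_dense_same_slab {d : ℕ} {J : Type*} [Finite J] (x : J → Fin d → ℝ)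
    {D : Set ((Fin d → Fin d → ℝ) × (Fin d → ℝ) × ℝ × ℝ)} (hD : Dense D)
    (W : Matrix (Fin d) (Fin d) ℝ) (v : Fin d → ℝ) {a b : ℝ} (hab : a < b) :
    ∃ θ ∈ D, θ.2.2.1 < θ.2.2.2 ∧ ∀ j,
      (θ.2.2.1 ≤ quadFn (Matrix.of θ.1) θ.2.1 (x j) ∧
        quadFn (Matrix.of θ.1) θ.2.1 (x j) ≤ θ.2.2.2) ↔
      (a ≤ quadFn W v (x j) ∧ quadFn W v (x j) ≤ b) := by
  let q : (Fin d → Fin d → ℝ) × (Fin d → ℝ) × ℝ × ℝ → J → ℝ := fun θ j =>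
    quadFn (Matrix.of θ.1) θ.2.1 (x j)
  have hq : ∀ j, Continuous fun θ => q θ j := fun j => by
    simp only [q, quadFn, Matrix.of_apply]
    fun_prop
  obtain ⟨a', ha', haj⟩ : ∃ a' < a, ∀ j, quadFn W v (x j) < a → quadFn W v (x j) < a' := by
    have h1 : ∀ᶠ a' in nhdsWithin a (Set.Iio a), ∀ j, quadFn W v (x j) < a →
        quadFn W v (x j) < a' := by
      refine Filter.eventually_all.2 fun j => ?_
      by_cases h : quadFn W v (x j) < a
      · filter_upwards [nhdsWithin_le_nhds (lt_mem_nhds h)] with a' h' _ using h'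
      · exact Filter.Eventually.of_forall fun _ h' => absurd h' h
    obtain ⟨a', h, h'⟩ := (h1.and self_mem_nhdsWithin).exists
    exact ⟨a', h', h⟩
  obtain ⟨b', hb', hbj⟩ : ∃ b' > b, ∀ j, b < quadFn W v (x j) → b' < quadFn W v (x j) := by
    have h1 : ∀ᶠ b' in nhdsWithin b (Set.Ioi b), ∀ j, b < quadFn W v (x j) →
        b' < quadFn W v (x j) := by
      refine Filter.eventually_all.2 fun j => ?_
      by_cases h : b < quadFn W v (x j)
      · filter_upwards [nhdsWithin_le_nhds (gt_mem_nhds h)] with b' h' _ using h'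
      · exact Filter.Eventually.of_forall fun _ h' => absurd h' h
    obtain ⟨b', h, h'⟩ := (h1.and self_mem_nhdsWithin).exists
    exact ⟨b', h', h⟩
  let θ₀ : (Fin d → Fin d → ℝ) × (Fin d → ℝ) × ℝ × ℝ := (W, v, a', b')
  have hθ₀ : ∀ j, q θ₀ j = quadFn W v (x j) := fun j => rfl
  have hev : ∀ᶠ θ in nhds θ₀, θ.2.2.1 < θ.2.2.2 ∧ ∀ j, (θ.2.2.1 ≤ q θ j ∧ q θ j ≤ θ.2.2.2) ↔
      (a ≤ quadFn W v (x j) ∧ quadFn W v (x j) ≤ b) := by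
    have hlt : ∀ f g : (Fin d → Fin d → ℝ) × (Fin d → ℝ) × ℝ × ℝ → ℝ, Continuous f →
        Continuous g → f θ₀ < g θ₀ → ∀ᶠ θ in nhds θ₀, f θ < g θ := fun f g hf hg h =>
      (isOpen_lt hf hg).mem_nhds h
    have hA : Continuous fun θ : (Fin d → Fin d → ℝ) × (Fin d → ℝ) × ℝ × ℝ => θ.2.2.1 := by
      fun_prop
    have hB : Continuous fun θ : (Fin d → Fin d → ℝ) × (Fin d → ℝ) × ℝ × ℝ => θ.2.2.2 := by
      fun_prop
    refine (hlt _ _ hA hB (ha'.trans (hab.trans hb'))).and (Filter.eventually_all.2 fun j => ?_)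
    rcases lt_or_ge (quadFn W v (x j)) a with h | h
    · filter_upwards [hlt _ _ (hq j) hA (haj j h)] with θ hθ
      exact ⟨fun h' => absurd h'.1 hθ.not_ge, fun h' => absurd h'.1 h.not_ge⟩
    rcases lt_or_ge b (quadFn W v (x j)) with h2 | h2
    · filter_upwards [hlt _ _ hB (hq j) (hbj j h2)] with θ hθ
      exact ⟨fun h' => absurd h'.2 hθ.not_ge, fun h' => absurd h'.2 h2.not_ge⟩
    · filter_upwards [hlt _ _ hA (hq j) (ha'.trans_le h), hlt _ _ (hq j) hB (h2.trans_lt hb')]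
        with θ h3 h4
      exact ⟨fun _ => ⟨h, h2⟩, fun _ => ⟨h3.le, h4.le⟩⟩
  obtain ⟨θ, hθ, hθD⟩ := mem_closure_iff_nhds.1 (hD θ₀) _ hev
  exact ⟨θ, hθD, hθ⟩

theorem exists_slab_of_sInf_WSCplus_lt {d N : ℕ} {𝒴 : Type*} (hN : 1 ≤ N)
    (ω : Fin N → (Fin d → ℝ) × 𝒴) (C : (Fin d → ℝ) → Set 𝒴) {δ : ℝ} (hδ0 : 0 < δ) (hδ1 : δ ≤ 1)
    {t : ℝ} (h : sInf {r : ℝ | ∃ (W : Matrix (Fin d) (Fin d) ℝ) (v : Fin d → ℝ),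
      r = WSCplus ω C δ (quadFn W v)} < t) :
    ∃ (W : Matrix (Fin d) (Fin d) ℝ) (v : Fin d → ℝ) (a b : ℝ), a < b ∧
      δ * N ≤ (Nat.card {i // a ≤ quadFn W v (ω i).1 ∧ quadFn W v (ω i).1 ≤ b} : ℝ) ∧
      (Nat.card {i // (a ≤ quadFn W v (ω i).1 ∧ quadFn W v (ω i).1 ≤ b) ∧
        (ω i).2 ∈ C (ω i).1} : ℝ) ≤
        t * Nat.card {i // a ≤ quadFn W v (ω i).1 ∧ quadFn W v (ω i).1 ≤ b} := by
  have hN' : (0 : ℝ) < N := by exact_mod_cast hN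
  obtain ⟨_, ⟨W, v, rfl⟩, hWv⟩ := exists_lt_of_csInf_lt (by exact ⟨_, 0, 0, rfl⟩) h
  obtain ⟨_, ⟨a, b, hab, hmass, rfl⟩, hr⟩ := exists_lt_of_csInf_lt (by
    obtain ⟨M, hM⟩ := (Set.finite_range fun i => |quadFn W v (ω i).1|).bddAbove
    have hM' : ∀ i, |quadFn W v (ω i).1| ≤ M := fun i => hM ⟨i, rfl⟩
    have hM0 : 0 ≤ M := (abs_nonneg _).trans (hM' ⟨0, hN⟩)
    refine ⟨_, -(M + 1), M + 1, by linarith, ?_, rfl⟩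
    have hall : ∀ i, -(M + 1) ≤ quadFn W v (ω i).1 ∧ quadFn W v (ω i).1 ≤ M + 1 := fun i => by
      have := abs_le.1 (hM' i)
      constructor <;> linarith
    rw [Nat.card_congr (Equiv.subtypeUnivEquiv hall), Nat.card_fin, div_self hN'.ne']
    exact hδ1) hWv
  rw [le_div_iff₀ hN'] at hmass
  refine ⟨W, v, a, b, hab, hmass, ?_⟩
  rw [div_lt_iff₀ ((mul_pos hδ0 hN').trans_le hmass)] at hr
  exact hr.le

theorem sInf_WSCplus_nonneg {d N : ℕ} {𝒴 : Type*} (ω : Fin N → (Fin d → ℝ) × 𝒴)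
    (C : (Fin d → ℝ) → Set 𝒴) (δ : ℝ) :
    0 ≤ sInf {r : ℝ | ∃ (W : Matrix (Fin d) (Fin d) ℝ) (v : Fin d → ℝ),
      r = WSCplus ω C δ (quadFn W v)} := by
  refine Real.sInf_nonneg ?_
  rintro _ ⟨W, v, rfl⟩
  refine Real.sInf_nonneg ?_
  rintro _ ⟨a, b, -, -, rfl⟩
  positivity

theorem growth_mul_exp_le {d N : ℕ} (hd : 1 ≤ d) (hN : 2 ≤ N) {τ : ℝ} (hτ : 0 ≤ τ) :
    (((N * 2 + 1) ^ (2 * (d * d + d + 1)) : ℕ) : ℝ) *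
      Real.exp (-(25 * ((d : ℝ) ^ 2 * Real.log N + τ))) ≤ Real.exp (-τ) := by
  have hN0 : (0 : ℝ) < N := by exact_mod_cast (by omega : 0 < N)
  have h1 : (N * 2 + 1) ^ (2 * (d * d + d + 1)) ≤ N ^ (18 * (d * d)) :=
    calc (N * 2 + 1) ^ (2 * (d * d + d + 1)) ≤ (N ^ 3) ^ (2 * (d * d + d + 1)) := by
          gcongr
          nlinarith [Nat.mul_le_mul hN hN, Nat.mul_le_mul (Nat.mul_le_mul hN hN) (le_refl N)]
      _ ≤ (N ^ 3) ^ (2 * (3 * (d * d))) := by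
          gcongr
          · exact Nat.one_le_pow _ _ (by omega)
          · nlinarith
      _ = N ^ (18 * (d * d)) := by rw [← pow_mul]; congr 1; ring
  have h2 : ((N ^ (18 * (d * d)) : ℕ) : ℝ) = Real.exp (18 * ((d : ℝ) ^ 2 * Real.log N)) := by
    rw [show 18 * ((d : ℝ) ^ 2 * Real.log N) = ((18 * (d * d) : ℕ) : ℝ) * Real.log N by
      push_cast; ring, Real.exp_nat_mul, Real.exp_log hN0]
    push_cast
    rfl
  have h3 : 0 ≤ (d : ℝ) ^ 2 * Real.log N :=
    mul_nonneg (sq_nonneg _) (Real.log_natCast_nonneg N)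
  calc _ ≤ Real.exp (18 * ((d : ℝ) ^ 2 * Real.log N)) *
        Real.exp (-(25 * ((d : ℝ) ^ 2 * Real.log N + τ))) := by
        rw [← h2]
        gcongr
    _ ≤ _ := by
        rw [← Real.exp_add]
        exact Real.exp_le_exp.2 (by linarith)

/-- Proposition 2: there is a universal constant `K > 0` such that if the predictor `C`
provides conditional coverage at level `1 − α` over all quadratic slabs, i.e.
`P(Y ∈ C(X), a ≤ π(X) ≤ b) ≥ (1−α)·P(a ≤ π(X) ≤ b)` for every quadratic `π` and `a < b`,
then for an i.i.d. sample of size `N` and every `τ > 0`, with probability at least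
`1 − e^{−τ}`, `inf_{π} WSC⁺_n(C, π) ≥ 1 − α − K·√((d²·log N + τ)/(δ·N))`. -/
theorem stmt5 :
    ∃ K : ℝ, 0 < K ∧
      ∀ (d : ℕ) (𝒴 : Type) [MeasurableSpace 𝒴]
        (P : Measure ((Fin d → ℝ) × 𝒴)) [IsProbabilityMeasure P]
        (C : (Fin d → ℝ) → Set 𝒴),
          MeasurableSet {p : (Fin d → ℝ) × 𝒴 | p.2 ∈ C p.1} →
        ∀ (δ : ℝ), δ ∈ Set.Ioc (0 : ℝ) 1 →
        ∀ (α : ℝ), α ∈ Set.Ioo (0 : ℝ) 1 →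
        (∀ (W : Matrix (Fin d) (Fin d) ℝ) (v : Fin d → ℝ) (a b : ℝ), a < b →
          ENNReal.ofReal (1 - α) *
              P {p : (Fin d → ℝ) × 𝒴 | a ≤ quadFn W v p.1 ∧ quadFn W v p.1 ≤ b} ≤
            P {p : (Fin d → ℝ) × 𝒴 |
                (a ≤ quadFn W v p.1 ∧ quadFn W v p.1 ≤ b) ∧ p.2 ∈ C p.1}) →
        ∀ (N : ℕ), 1 ≤ N →
        ∀ (τ : ℝ), 0 < τ →
        ENNReal.ofReal (1 - Real.exp (-τ)) ≤
          (Measure.pi fun _ : Fin N => P)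
            {ω : Fin N → (Fin d → ℝ) × 𝒴 |
              1 - α - K * Real.sqrt (((d : ℝ) ^ 2 * Real.log N + τ) / (δ * N)) ≤
                sInf {r : ℝ | ∃ (W : Matrix (Fin d) (Fin d) ℝ) (v : Fin d → ℝ),
                  r = WSCplus ω C δ (quadFn W v)}} := by
  refine ⟨30, by norm_num, ?_⟩
  intro d 𝒴 _ P _ C hC δ hδ α hα hcov N hN τ hτ
  obtain ⟨hδ0, hδ1⟩ := hδ
  obtain ⟨hα0, hα1⟩ := hα
  have hN0 : (0 : ℝ) < N := by exact_mod_cast hN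
  have hlog : 0 ≤ (d : ℝ) ^ 2 * Real.log N :=
    mul_nonneg (sq_nonneg _) (Real.log_natCast_nonneg N)
  have hApos : 0 < ((d : ℝ) ^ 2 * Real.log N + τ) / (δ * N) := by positivity
  set ε := 30 * Real.sqrt (((d : ℝ) ^ 2 * Real.log N + τ) / (δ * N)) with hε
  have hε0 : 0 < ε := by positivity
  have hexp : ε ^ 2 * (δ * N) / 36 = 25 * ((d : ℝ) ^ 2 * Real.log N + τ) := by
    rw [hε, mul_pow, Real.sq_sqrt hApos.le]
    field_simp
    norm_num
  set good := {ω : Fin N → (Fin d → ℝ) × 𝒴 | 1 - α - ε ≤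
    sInf {r : ℝ | ∃ (W : Matrix (Fin d) (Fin d) ℝ) (v : Fin d → ℝ),
      r = WSCplus ω C δ (quadFn W v)}} with hgood
  suffices h : (Measure.pi fun _ : Fin N => P) goodᶜ ≤ ENNReal.ofReal (Real.exp (-τ)) by
    rw [ENNReal.ofReal_sub _ (Real.exp_pos _).le, ENNReal.ofReal_one, tsub_le_iff_right]
    calc (1 : ENNReal) = (Measure.pi fun _ : Fin N => P) (good ∪ goodᶜ) := by simp
      _ ≤ _ := (measure_union_le _ _).trans (by gcongr)
  rcases lt_or_ge 1 ε with hε1 | hε1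
  · have : goodᶜ = ∅ := by
      rw [Set.compl_empty_iff, Set.eq_univ_iff_forall]
      intro ω
      have := sInf_WSCplus_nonneg ω C δ
      rw [hgood, Set.mem_ofPred_eq]
      linarith
    simp [this]
  let slab : (Fin d → Fin d → ℝ) × (Fin d → ℝ) × ℝ × ℝ → Set ((Fin d → ℝ) × 𝒴) := fun θ =>
    {p | θ.2.2.1 ≤ quadFn (Matrix.of θ.1) θ.2.1 p.1 ∧
      quadFn (Matrix.of θ.1) θ.2.1 p.1 ≤ θ.2.2.2}
  let K : Set ((Fin d → ℝ) × 𝒴) := {p | p.2 ∈ C p.1}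
  have hslab : ∀ θ, MeasurableSet (slab θ) := fun θ => by
    have : Measurable fun p : (Fin d → ℝ) × 𝒴 => quadFn (Matrix.of θ.1) θ.2.1 p.1 := by
      unfold quadFn
      fun_prop
    exact (measurableSet_le measurable_const this).inter
      (measurableSet_le this measurable_const)
  have hcovR : ∀ θ, θ.2.2.1 < θ.2.2.2 → (1 - α) * P.real (slab θ) ≤ P.real (slab θ ∩ K) := by
    intro θ hθ
    have h := ENNReal.toReal_mono (measure_ne_top P _)
      (hcov (Matrix.of θ.1) θ.2.1 θ.2.2.1 θ.2.2.2 hθ)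
    rwa [ENNReal.toReal_mul, ENNReal.toReal_ofReal (by linarith)] at h
  by_cases hcase : d = 0 ∨ N = 1
  · have hsame : ∀ (ω : Fin N → (Fin d → ℝ) × 𝒴) i j, (ω i).1 = (ω j).1 := by
      rcases hcase with rfl | rfl
      · exact fun ω i j => Subsingleton.elim _ _
      · exact fun ω i j => by rw [Subsingleton.elim i j]
    have huniv : slab (0, 0, -1, 1) = Set.univ := by
      ext p
      simp [slab, quadFn]
    refine le_trans (measure_mono ?_) ((measure_pi_exists_coverage_le P
      (fun _ : Unit => Set.univ) K (fun _ => .univ) hC (by linarith : (0 : ℝ) ≤ 1 - α)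
      (by linarith) hε0 hε1 (fun _ => huniv ▸ hcovR _ (by norm_num)) 1
      (fun z => ⟨{Finset.univ}, by simp, by simp⟩) (δ * N)).trans
        (ENNReal.ofReal_le_ofReal ?_))
    · intro ω hω
      obtain ⟨W, v, a, b, -, hmass, hlt⟩ := exists_slab_of_sInf_WSCplus_lt hN ω C hδ0 hδ1
        (not_le.1 hω)
      have hpos : 0 < Nat.card {i // a ≤ quadFn W v (ω i).1 ∧ quadFn W v (ω i).1 ≤ b} := by
        exact_mod_cast (mul_pos hδ0 hN0).trans_le hmass
      obtain ⟨⟨⟨i₀, hi₀⟩⟩, -⟩ := Nat.card_pos_iff.1 hpos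
      have hall : ∀ i, (a ≤ quadFn W v (ω i).1 ∧ quadFn W v (ω i).1 ≤ b) ↔ True := fun i => by
        rw [hsame ω i i₀]
        exact iff_true_intro hi₀
      simp only [hall, true_and] at hmass hlt
      refine ⟨(), ?_, ?_⟩
      · exact hmass
      · simp only [Set.univ_inter]
        exact hlt
    · rw [hexp, Nat.cast_one, one_mul]
      exact Real.exp_le_exp.2 (by linarith)
  · push Not at hcase
    let u := TopologicalSpace.denseSeq ((Fin d → Fin d → ℝ) × (Fin d → ℝ) × ℝ × ℝ)
    refine le_trans (measure_mono ?_) ((measure_pi_exists_coverage_le P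
      (fun k : {n : ℕ // (u n).2.2.1 < (u n).2.2.2} => slab (u k)) K (fun k => hslab _) hC
      (by linarith : (0 : ℝ) ≤ 1 - α) (by linarith) hε0 hε1 (fun k => hcovR _ k.2)
      ((N * 2 + 1) ^ (2 * (d * d + d + 1))) ?_ (δ * N)).trans (ENNReal.ofReal_le_ofReal ?_))
    · intro ω hω
      obtain ⟨W, v, a, b, hab, hmass, hlt⟩ := exists_slab_of_sInf_WSCplus_lt hN ω C hδ0 hδ1
        (not_le.1 hω)
      obtain ⟨_, ⟨n, rfl⟩, hn, hpat⟩ := exists_mem_dense_same_slab (fun i => (ω i).1)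
        (TopologicalSpace.denseRange_denseSeq _) W v hab
      simp only [← hpat] at hmass hlt
      exact ⟨⟨n, hn⟩, hmass, hlt⟩
    · intro z
      obtain ⟨𝒜, hcard, h𝒜⟩ := exists_finset_slab_patterns fun j => (z j).1
      exact ⟨𝒜, by simpa using hcard, fun k => h𝒜 _ _ _ _⟩
    · rw [hexp]
      exact growth_mul_exp_le (by omega) (by omega) hτ.le
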